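/- Let S be a separable metric space, G = (G_n) an increasing filtration with G_∞ = σ(∪_n G_n), and Y_n, Z_n S-valued random variables with σ(Y_n) ⊂ G_n and σ(Z_n) ⊂ G_∞ for all n. Let M and N be random probability measures (kernels) on S. If Y_n → M stably and Z_n → N G-stably in strong sense, then (Y_n, Z_n) → M × N stably, where (M × N)(ω) = M(ω) ⊗ N(ω) is the product kernel on S × S. -/

import Mathlib

open MeasureTheory ProbabilityTheory Filter

lemma tens_weak {S : Type*} [MetricSpace S] [SecondCountableTopology S]
    [MeasurableSpace S] [BorelSpace S] (P : ℕ → ProbabilityMeasure (S × S))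
    (Q : ProbabilityMeasure (S × S))
    (h : ∀ f g : BoundedContinuousFunction S ℝ,
      Tendsto (fun n => ∫ x, f x.1 * g x.2 ∂(P n : Measure (S × S))) atTop
        (nhds (∫ x, f x.1 * g x.2 ∂(Q : Measure (S × S))))) :
    Tendsto P atTop (nhds Q) := by
  let T : Submonoid (BoundedContinuousFunction (S × S) ℝ) :=
    { carrier := {u | ∃ f g : BoundedContinuousFunction S ℝ, ∀ x, u x = f x.1 * g x.2}
      mul_mem' := by
        rintro a b ⟨f, g, hfg⟩ ⟨f', g', hfg'⟩
        refine ⟨f * f', g * g', fun x => ?_⟩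
        simp only [BoundedContinuousFunction.mul_apply, hfg, hfg']
        ring
      one_mem' := ⟨1, 1, fun x => by simp⟩ }
  let A := Algebra.adjoin ℝ (T : Set (BoundedContinuousFunction (S × S) ℝ))
  have hA : ∀ u ∈ A, Tendsto (fun n => ∫ x, u x ∂(P n : Measure (S × S))) atTop
        (nhds (∫ x, u x ∂(Q : Measure (S × S)))) := by
    intro u hu
    have hu' : u ∈ Submodule.span ℝ (T : Set (BoundedContinuousFunction (S × S) ℝ)) := by
      have : u ∈ Subalgebra.toSubmodule A := hu
      rw [Algebra.adjoin_eq_span, Submonoid.closure_eq] at this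
      exact this
    induction hu' using Submodule.span_induction with
    | mem x hx =>
      obtain ⟨f, g, hfg⟩ := hx
      simp only [hfg]
      exact h f g
    | zero => simp
    | add x y hx hy ihx ihy =>
      have e : ∀ ν : ProbabilityMeasure (S × S), ∫ z, (x + y) z ∂(ν : Measure (S × S)) =
          ∫ z, x z ∂(ν : Measure (S × S)) + ∫ z, y z ∂(ν : Measure (S × S)) := fun ν =>
        integral_add (x.integrable _) (y.integrable _)
      simp only [e]
      have key : ∀ v ∈ Submodule.span ℝ (T : Set (BoundedContinuousFunction (S × S) ℝ)), v ∈ A := by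
        intro v hv
        have : v ∈ Subalgebra.toSubmodule A := by
          rw [Algebra.adjoin_eq_span, Submonoid.closure_eq]; exact hv
        exact this
      exact (ihx (key _ hx)).add (ihy (key _ hy))
    | smul a x hx ihx =>
      have key : ∀ v ∈ Submodule.span ℝ (T : Set (BoundedContinuousFunction (S × S) ℝ)), v ∈ A := by
        intro v hv
        have : v ∈ Subalgebra.toSubmodule A := by
          rw [Algebra.adjoin_eq_span, Submonoid.closure_eq]; exact hv
        exact this
      have e : ∀ ν : ProbabilityMeasure (S × S), ∫ z, (a • x) z ∂(ν : Measure (S × S)) =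
          a * ∫ z, x z ∂(ν : Measure (S × S)) := fun ν => integral_const_mul _ _
      simp only [e]
      exact (ihx (key _ hx)).const_mul a
  apply tendsto_of_forall_isOpen_le_liminf_nat
  intro G hG
  refine (le_liminf_iff (isCoboundedUnder_ge_of_le (x := 1) _ (by simp)) (by isBoundedDefault)).2
    (fun r hr ↦ ?_)
  -- bumps
  have bump : ∀ p : G, ∃ u : BoundedContinuousFunction (S × S) ℝ, u ∈ A ∧ (∀ x, 0 ≤ u x) ∧
      (∀ x, u x ≤ 1) ∧ (∀ x, x ∉ G → u x = 0) ∧ 0 < u p := by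
    intro p
    obtain ⟨ε, εpos, hε⟩ := Metric.isOpen_iff.1 hG p.1 p.2
    let φ : S → BoundedContinuousFunction S ℝ := fun q =>
      BoundedContinuousFunction.ofNormedAddCommGroup (fun x => max 0 (1 - dist x q / ε))
        (by fun_prop) 1 (by
          intro x
          have : 0 ≤ dist x q / ε := by positivity
          rw [Real.norm_of_nonneg (le_max_left _ _)]
          exact max_le zero_le_one (by linarith))
    have hφ : ∀ q x, φ q x = max 0 (1 - dist x q / ε) := fun q x => rfl
    have h0 : ∀ q x, 0 ≤ φ q x := fun q x => le_max_left _ _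
    have h1 : ∀ q x, φ q x ≤ 1 := fun q x => by
      have : 0 ≤ dist x q / ε := by positivity
      exact max_le zero_le_one (by linarith)
    have hz : ∀ q x, ε ≤ dist x q → φ q x = 0 := fun q x hx => by
      rw [hφ, max_eq_left]
      have : 1 ≤ dist x q / ε := by rwa [one_le_div εpos]
      linarith
    refine ⟨(φ p.1.1).compContinuous ⟨Prod.fst, continuous_fst⟩ *
      (φ p.1.2).compContinuous ⟨Prod.snd, continuous_snd⟩,
      Algebra.subset_adjoin ⟨φ p.1.1, φ p.1.2, fun x => rfl⟩, fun x => ?_, fun x => ?_,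
      fun x hx => ?_, ?_⟩
    · exact mul_nonneg (h0 _ _) (h0 _ _)
    · exact mul_le_one₀ (h1 _ _) (h0 _ _) (h1 _ _)
    · change φ p.1.1 x.1 * φ p.1.2 x.2 = 0
      by_contra hne
      apply hx
      apply hε
      rw [Metric.mem_ball, Prod.dist_eq, max_lt_iff]
      constructor
      · by_contra hc
        exact hne (by rw [hz _ _ (not_lt.1 hc), zero_mul])
      · by_contra hc
        exact hne (by rw [hz p.1.2 _ (not_lt.1 hc), mul_zero])
    · change 0 < φ p.1.1 p.1.1 * φ p.1.2 p.1.2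
      simp [hφ]
  choose u uA u0 u1 uG up using bump
  obtain ⟨T₀, T₀c, hT₀⟩ := TopologicalSpace.isOpen_iUnion_countable (fun p : G => {x | 0 < u p x})
    (fun p => isOpen_lt continuous_const (u p).continuous)
  have cover : ∀ x ∈ G, ∃ p ∈ T₀, 0 < u p x := by
    intro x hx
    have : x ∈ ⋃ p : G, {x | 0 < u p x} := Set.mem_iUnion.2 ⟨⟨x, hx⟩, up ⟨x, hx⟩⟩
    rw [← hT₀] at this
    simpa using this
  rcases T₀.eq_empty_or_nonempty with he | hne
  · have : G = ∅ := by
      ext x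
      simp only [Set.mem_empty_iff_false, iff_false]
      intro hx
      obtain ⟨p, hp, -⟩ := cover x hx
      simp [he] at hp
    rw [this] at hr
    simp at hr
  obtain ⟨e, rfl⟩ := T₀c.exists_eq_range hne
  let w : ℕ → BoundedContinuousFunction (S × S) ℝ := fun k =>
    1 - (∏ i ∈ Finset.range k, (1 - u (e i))) ^ k
  have wA : ∀ k, w k ∈ A := fun k =>
    A.sub_mem A.one_mem (A.pow_mem (A.prod_mem fun i _ => A.sub_mem A.one_mem (uA _)) _)
  have wx : ∀ k x, w k x = 1 - (∏ i ∈ Finset.range k, (1 - u (e i) x)) ^ k := by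
    intro k x
    simp [w, BoundedContinuousFunction.coe_prod]
  have p0 : ∀ k x, 0 ≤ ∏ i ∈ Finset.range k, (1 - u (e i) x) := fun k x =>
    Finset.prod_nonneg fun i _ => by linarith [u1 (e i) x]
  have p1 : ∀ k x, ∏ i ∈ Finset.range k, (1 - u (e i) x) ≤ 1 := fun k x =>
    Finset.prod_le_one (fun i _ => by linarith [u1 (e i) x]) fun i _ => by linarith [u0 (e i) x]
  have w0 : ∀ k x, 0 ≤ w k x := fun k x => by
    rw [wx]; linarith [pow_le_one₀ (n := k) (p0 k x) (p1 k x)]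
  have w1 : ∀ k x, w k x ≤ G.indicator 1 x := fun k x => by
    by_cases hx : x ∈ G
    · rw [wx]; simp [hx]; exact pow_nonneg (p0 k x) _
    · rw [wx]; simp [hx, uG _ x hx]
  have wlim : ∀ x, Tendsto (fun k => w k x) atTop (nhds (G.indicator 1 x)) := by
    intro x
    by_cases hx : x ∈ G
    · obtain ⟨_, ⟨i, rfl⟩, hi⟩ := cover x hx
      have : Tendsto (fun k => (∏ i ∈ Finset.range k, (1 - u (e i) x)) ^ k) atTop (nhds 0) := by
        refine squeeze_zero' (Eventually.of_forall fun k => pow_nonneg (p0 k x) k) ?_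
          (tendsto_pow_atTop_nhds_zero_of_lt_one (r := 1 - u (e i) x)
            (by linarith [u1 (e i) x]) (by linarith))
        filter_upwards [eventually_gt_atTop i] with k hk
        gcongr
        · exact p0 k x
        rw [← Finset.mul_prod_erase _ _ (Finset.mem_range.2 hk)]
        refine mul_le_of_le_one_right (by linarith [u1 (e i) x]) ?_
        exact Finset.prod_le_one (fun i _ => by linarith [u1 (e i) x])
          fun i _ => by linarith [u0 (e i) x]
      simp only [wx]
      simpa [hx] using this.const_sub 1
    · simp only [wx]
      simp [hx, uG _ x hx]
  have ilim : Tendsto (fun k => ∫ x, w k x ∂(Q : Measure (S × S))) atTop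
      (nhds ((Q : Measure (S × S)).real G)) := by
    rw [← integral_indicator_one hG.measurableSet]
    refine tendsto_integral_of_dominated_convergence (fun _ => 1)
      (fun k => (w k).continuous.aestronglyMeasurable) (integrable_const _) (fun k => ?_) ?_
    · refine Eventually.of_forall fun x => ?_
      rw [Real.norm_of_nonneg (w0 k x)]
      exact (w1 k x).trans (Set.indicator_le_self' (by simp) x)
    · exact Eventually.of_forall wlim
  have hr' : (r : ℝ) < (Q : Measure (S × S)).real G := by
    have : (r : ℝ) < (Q G : ℝ) := by exact_mod_cast hr
    simpa using this
  obtain ⟨k, hk⟩ := ((tendsto_order.1 ilim).1 _ hr').exists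
  filter_upwards [(tendsto_order.1 (hA _ (wA k))).1 _ hk] with n hn
  have : ∫ x, w k x ∂(P n : Measure (S × S)) ≤ (P n : Measure (S × S)).real G := by
    rw [← integral_indicator_one hG.measurableSet]
    refine integral_mono ((w k).integrable _) ?_ (w1 k)
    exact (integrable_indicator_iff hG.measurableSet).2 (integrable_const _).integrableOn
  have h2 : (r : ℝ) < (P n G : ℝ) := by
    have := hn.trans_le this
    simpa using this
  exact_mod_cast h2

lemma int_small {Ω : Type*} [MeasurableSpace Ω] {μ : Measure Ω}
    (w x : ℕ → Ω → ℝ) (C : ℝ) (hw : ∀ n, Integrable (w n) μ)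
    (hx : ∀ n, ∀ᵐ ω ∂μ, |x n ω| ≤ C)
    (h : Tendsto (fun n => ∫ ω, |w n ω| ∂μ) atTop (nhds 0)) :
    Tendsto (fun n => ∫ ω, w n ω * x n ω ∂μ) atTop (nhds 0) := by
  have h' := h.mul_const C
  rw [zero_mul] at h'
  refine squeeze_zero_norm (fun n => ?_) h'
  rw [← integral_mul_const]
  refine norm_integral_le_of_norm_le ((hw n).abs.mul_const C) ?_
  filter_upwards [hx n] with ω hω
  rw [Real.norm_eq_abs, abs_mul]
  gcongr

lemma int_meas {Ω : Type*} [MeasurableSpace Ω] {μ : Measure Ω} [IsFiniteMeasure μ]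
    (u : ℕ → Ω → ℝ) (v : Ω → ℝ) (C : ℝ) (hu : ∀ n, AEStronglyMeasurable (u n) μ)
    (hv : AEStronglyMeasurable v μ)
    (hx : ∀ n, ∀ᵐ ω ∂μ, |u n ω| ≤ C) (hvC : ∀ ω, |v ω| ≤ C)
    (h : TendstoInMeasure μ u atTop v) :
    Tendsto (fun n => ∫ ω, |u n ω - v ω| ∂μ) atTop (nhds 0) := by
  refine tendsto_of_subseq_tendsto fun ns hns => ?_
  obtain ⟨ms, _, hms⟩ := TendstoInMeasure.exists_seq_tendsto_ae (fun ε hε => (h ε hε).comp hns)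
  refine ⟨ms, ?_⟩
  have : (0:ℝ) = ∫ ω, (0:ℝ) ∂μ := by simp
  rw [this]
  refine tendsto_integral_of_dominated_convergence (fun _ => C + C)
      (fun k => ((hu _).sub hv).norm) (integrable_const _) (fun k => ?_) ?_
  · filter_upwards [hx (ns (ms k))] with ω hω
    rw [Real.norm_eq_abs, abs_abs]
    exact (abs_sub _ _).trans (add_le_add hω (hvC ω))
  · filter_upwards [hms] with ω hω
    have := (hω.sub_const (v ω)).abs
    simpa using this

lemma pull {Ω : Type*} {m m0 : MeasurableSpace Ω} {μ : Measure Ω} [IsFiniteMeasure μ]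
    (hm : m ≤ m0) (W X : Ω → ℝ) (hX : StronglyMeasurable[m] X) (hW : Integrable W μ)
    (hWX : Integrable (fun ω => W ω * X ω) μ) :
    ∫ ω, W ω * X ω ∂μ = ∫ ω, (μ[W | m]) ω * X ω ∂μ := by
  have h := condExp_mul_of_stronglyMeasurable_right hX hWX hW
  calc ∫ ω, W ω * X ω ∂μ = ∫ ω, (μ[W * X | m]) ω ∂μ := (integral_condExp hm).symm
    _ = _ := integral_congr_ae h

lemma stable_ext {Ω : Type*} [MeasurableSpace Ω] {μ : Measure Ω} [IsFiniteMeasure μ]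
    (F : ℕ → Ω → ℝ) (L : Ω → ℝ) (C : ℝ) (hF : ∀ n, Measurable (F n)) (hL : Measurable L)
    (hFC : ∀ n ω, |F n ω| ≤ C) (hLC : ∀ ω, |L ω| ≤ C)
    (h : ∀ H, MeasurableSet H → Tendsto (fun n => ∫ ω in H, F n ω ∂μ) atTop
      (nhds (∫ ω in H, L ω ∂μ))) (W : Ω → ℝ) (hW : Integrable W μ) :
    Tendsto (fun n => ∫ ω, W ω * F n ω ∂μ) atTop (nhds (∫ ω, W ω * L ω ∂μ)) := by
  have hint : ∀ (V X : Ω → ℝ), Integrable V μ → Measurable X → (∀ ω, |X ω| ≤ C) →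
      Integrable (fun ω => V ω * X ω) μ := fun V X hV hX hXC =>
    hV.mul_bdd (c := C) hX.aestronglyMeasurable (Eventually.of_forall hXC)
  have hbd : ∀ (V V' X : Ω → ℝ), Integrable V μ → Integrable V' μ → Measurable X →
      (∀ ω, |X ω| ≤ C) →
      |∫ ω, V ω * X ω ∂μ - ∫ ω, V' ω * X ω ∂μ| ≤ (∫ ω, |V ω - V' ω| ∂μ) * C := by
    intro V V' X hV hV' hX hXC
    rw [← integral_sub (hint V X hV hX hXC) (hint V' X hV' hX hXC), ← integral_mul_const]
    have hi : Integrable (fun ω => |V ω - V' ω| * C) μ := (hV.sub hV').abs.mul_const C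
    rw [← Real.norm_eq_abs]
    refine norm_integral_le_of_norm_le hi ?_
    filter_upwards with ω
    rw [← sub_mul, Real.norm_eq_abs, abs_mul]
    exact mul_le_mul_of_nonneg_left (hXC ω) (abs_nonneg _)
  refine Integrable.induction (P := fun W => Tendsto (fun n => ∫ ω, W ω * F n ω ∂μ) atTop
    (nhds (∫ ω, W ω * L ω ∂μ))) ?_ ?_ ?_ ?_ hW
  · intro c s hs hμ
    have e : ∀ X : Ω → ℝ, ∫ ω, s.indicator (fun _ => c) ω * X ω ∂μ = c * ∫ ω in s, X ω ∂μ := by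
      intro X
      rw [← integral_const_mul, ← integral_indicator hs]
      congr 1
      ext ω
      by_cases hω : ω ∈ s <;> simp [hω]
    simp only [e]
    exact (h s hs).const_mul c
  · intro f g hd hf hg ihf ihg
    have e : ∀ X : Ω → ℝ, Measurable X → (∀ ω, |X ω| ≤ C) → ∫ ω, (f + g) ω * X ω ∂μ =
        ∫ ω, f ω * X ω ∂μ + ∫ ω, g ω * X ω ∂μ := by
      intro X hX hXC
      rw [← integral_add (hint f X hf hX hXC) (hint g X hg hX hXC)]
      simp [add_mul]
    rw [e L hL hLC]
    simp only [e _ (hF _) (hFC _)]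
    exact ihf.add ihg
  · refine isClosed_of_closure_subset fun V hV => ?_
    rw [Set.mem_ofPred_eq, Metric.tendsto_atTop]
    intro ε hε
    have hC : 0 ≤ |C| := abs_nonneg C
    obtain ⟨V', hV', hd⟩ := Metric.mem_closure_iff.1 hV (ε / (3 * (|C| + 1))) (by positivity)
    rw [Set.mem_ofPred_eq, Metric.tendsto_atTop] at hV'
    obtain ⟨n0, hn0⟩ := hV' (ε / 3) (by positivity)
    have hd' : (∫ ω, |V ω - V' ω| ∂μ) * C < ε / 3 := by
      rw [L1.dist_eq_integral_dist] at hd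
      simp only [Real.dist_eq] at hd
      have h0 : 0 ≤ ∫ ω, |V ω - V' ω| ∂μ := integral_nonneg fun _ => abs_nonneg _
      rw [lt_div_iff₀ (by positivity)] at hd
      nlinarith [le_abs_self C]
    refine ⟨n0, fun n hn => ?_⟩
    have a1 := hbd V V' (F n) (L1.integrable_coeFn V) (L1.integrable_coeFn V') (hF n) (hFC n)
    have a2 := hbd V V' L (L1.integrable_coeFn V) (L1.integrable_coeFn V') hL hLC
    have a3 := hn0 n hn
    rw [Real.dist_eq] at a3 ⊢
    rw [abs_le] at a1 a2
    rw [abs_lt] at a3 ⊢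
    constructor <;> linarith [a1.1, a1.2, a2.1, a2.2, a3.1, a3.2]
  · intro f g hfg hf ih
    have e : ∀ X : Ω → ℝ, ∫ ω, g ω * X ω ∂μ = ∫ ω, f ω * X ω ∂μ := fun X =>
      integral_congr_ae (by filter_upwards [hfg] with ω hω using by rw [hω])
    simp only [e]
    exact ih

open scoped BoundedContinuousFunction in
lemma tens_conv
    {Ω : Type*} [m0 : MeasurableSpace Ω] {μ : Measure Ω} [IsProbabilityMeasure μ]
    {S : Type*} [MetricSpace S] [SecondCountableTopology S]
    [MeasurableSpace S] [BorelSpace S]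
    (G : Filtration ℕ m0)
    (Y Z : ℕ → Ω → S)
    (hY : ∀ n, Measurable[G n] (Y n))
    (hZ : ∀ n, Measurable[⨆ k, (G k : MeasurableSpace Ω)] (Z n))
    (M N : ProbabilityTheory.Kernel Ω S)
    [IsMarkovKernel M] [IsMarkovKernel N]
    (hYM : ∀ H : Set Ω, MeasurableSet H → 0 < μ H →
      ∀ f : S → ℝ, Continuous f → (∃ C, ∀ x, |f x| ≤ C) →
        Filter.Tendsto (fun n : ℕ => ∫ ω in H, f (Y n ω) ∂μ) Filter.atTop
          (nhds (∫ ω in H, (∫ x, f x ∂(M ω)) ∂μ)))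
    (hZN : ∀ f : S → ℝ, Continuous f → (∃ C, ∀ x, |f x| ≤ C) →
      MeasureTheory.TendstoInMeasure μ
        (fun n ω => (μ[(fun ω' => f (Z n ω')) | G n]) ω)
        Filter.atTop (fun ω => ∫ x, f x ∂(N ω)))
    (H : Set Ω) (hH : MeasurableSet H) (f g : S →ᵇ ℝ) :
    Tendsto (fun n => ∫ ω in H, f (Y n ω) * g (Z n ω) ∂μ) atTop
      (nhds (∫ ω in H, (∫ x, f x ∂(M ω)) * (∫ x, g x ∂(N ω)) ∂μ)) := by
  have hfb : ∀ x, |f x| ≤ ‖f‖ := fun x => f.norm_coe_le_norm x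
  have hgb : ∀ x, |g x| ≤ ‖g‖ := fun x => g.norm_coe_le_norm x
  have hGle : (⨆ k, (G k : MeasurableSpace Ω)) ≤ m0 := iSup_le fun k => G.le k
  set I : Ω → ℝ := H.indicator 1 with hI
  have hIi : Integrable I μ := (integrable_const (1:ℝ)).indicator hH
  have hIb : ∀ ω, |I ω| ≤ (1 : ℝ) := by
    intro ω; by_cases h : ω ∈ H <;> simp [hI, h]
  have hset : ∀ X : Ω → ℝ, ∫ ω in H, X ω ∂μ = ∫ ω, I ω * X ω ∂μ := by
    intro X
    rw [← integral_indicator hH]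
    congr 1
    ext ω
    by_cases hω : ω ∈ H <;> simp [hI, hω]
  set V : ℕ → Ω → ℝ := fun n => μ[(fun ω' => g (Z n ω')) | G n] with hV
  set U : ℕ → Ω → ℝ := fun n => μ[I | G n] with hU
  set Ui : Ω → ℝ := μ[I | ⨆ k, (G k : MeasurableSpace Ω)] with hUi
  set Mf : Ω → ℝ := fun ω => ∫ x, f x ∂(M ω) with hMf
  set Ng : Ω → ℝ := fun ω => ∫ x, g x ∂(N ω) with hNg
  have mF : ∀ n, StronglyMeasurable[G n] (fun ω => f (Y n ω)) := fun n =>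
    (f.continuous.measurable.comp (hY n)).stronglyMeasurable
  have mF0 : ∀ n, Measurable (fun ω => f (Y n ω)) := fun n => ((mF n).mono (G.le n)).measurable
  have mg : ∀ n, StronglyMeasurable[⨆ k, (G k : MeasurableSpace Ω)] (fun ω => g (Z n ω)) :=
    fun n => (g.continuous.measurable.comp (hZ n)).stronglyMeasurable
  have mg0 : ∀ n, Measurable (fun ω => g (Z n ω)) := fun n => ((mg n).mono hGle).measurable
  have mM : Measurable Mf := (f.continuous.stronglyMeasurable.integral_kernel (κ := M)).measurable
  have mN : Measurable Ng := (g.continuous.stronglyMeasurable.integral_kernel (κ := N)).measurable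
  have bM : ∀ ω, |Mf ω| ≤ ‖f‖ := fun ω => by
    simpa using norm_integral_le_of_norm_le_const (μ := M ω) (Eventually.of_forall f.norm_coe_le_norm)
  have bN : ∀ ω, |Ng ω| ≤ ‖g‖ := fun ω => by
    simpa using norm_integral_le_of_norm_le_const (μ := N ω) (Eventually.of_forall g.norm_coe_le_norm)
  have gi : ∀ n, Integrable (fun ω => g (Z n ω)) μ := fun n =>
    Integrable.of_bound (mg0 n).aestronglyMeasurable ‖g‖ (Eventually.of_forall fun ω => hgb _)
  have bV : ∀ n, ∀ᵐ ω ∂μ, |V n ω| ≤ ‖g‖ := fun n =>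
    ae_bdd_abs_condExp_of_ae_bdd_abs (Eventually.of_forall fun ω => hgb _)
  have bU : ∀ n, ∀ᵐ ω ∂μ, |U n ω| ≤ 1 := fun n =>
    ae_bdd_abs_condExp_of_ae_bdd_abs (Eventually.of_forall hIb)
  have mV : ∀ n, StronglyMeasurable[G n] (V n) := fun n => stronglyMeasurable_condExp
  have mU : ∀ n, StronglyMeasurable[G n] (U n) := fun n => stronglyMeasurable_condExp
  have mV0 : ∀ n, AEStronglyMeasurable (V n) μ := fun n =>
    ((mV n).mono (G.le n)).aestronglyMeasurable
  have bFg : ∀ n ω, |f (Y n ω) * g (Z n ω)| ≤ ‖f‖ * ‖g‖ := fun n ω => by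
    rw [abs_mul]; exact mul_le_mul (hfb _) (hgb _) (abs_nonneg _) (norm_nonneg _)
  have bFV : ∀ n, ∀ᵐ ω ∂μ, |f (Y n ω) * V n ω| ≤ ‖f‖ * ‖g‖ := fun n => by
    filter_upwards [bV n] with ω hω
    rw [abs_mul]; exact mul_le_mul (hfb _) hω (abs_nonneg _) (norm_nonneg _)
  -- step 1
  have s1 : ∀ n, ∫ ω, I ω * (f (Y n ω) * g (Z n ω)) ∂μ =
      ∫ ω, Ui ω * (f (Y n ω) * g (Z n ω)) ∂μ := fun n =>
    pull hGle I _ (((mF n).mono (le_iSup (fun k => (G k : MeasurableSpace Ω)) n)).mul (mg n)) hIi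
      (hIi.mul_bdd (c := ‖f‖ * ‖g‖) ((mF0 n).mul (mg0 n)).aestronglyMeasurable
        (Eventually.of_forall (bFg n)))
  -- step 2
  have s2 : Tendsto (fun n => ∫ ω, (U n ω - Ui ω) * (f (Y n ω) * g (Z n ω)) ∂μ) atTop (nhds 0) := by
    refine int_small _ _ (‖f‖ * ‖g‖) (fun n => integrable_condExp.sub integrable_condExp)
      (fun n => Eventually.of_forall (bFg n)) ?_
    have h := tendsto_eLpNorm_condExp (μ := μ) (ℱ := G) I
    have h2 := (ENNReal.tendsto_toReal ENNReal.zero_ne_top).comp h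
    refine Tendsto.congr (fun n => ?_) h2
    have hi : Integrable (U n - Ui) μ := integrable_condExp.sub integrable_condExp
    have := integral_norm_eq_lintegral_enorm hi.aestronglyMeasurable
    simp only [Function.comp, eLpNorm_one_eq_lintegral_enorm]
    exact this.symm
  -- step 3
  have iU : ∀ n, Integrable (U n) μ := fun n => integrable_condExp
  have iUi : Integrable Ui μ := integrable_condExp
  have iUF : ∀ n, Integrable (fun ω => U n ω * f (Y n ω)) μ := fun n =>
    (iU n).mul_bdd (c := ‖f‖) (mF0 n).aestronglyMeasurable (Eventually.of_forall fun _ => hfb _)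
  have s3 : ∀ n, ∫ ω, U n ω * (f (Y n ω) * g (Z n ω)) ∂μ =
      ∫ ω, I ω * (f (Y n ω) * V n ω) ∂μ := by
    intro n
    have a := pull (G.le n) (fun ω => g (Z n ω)) (fun ω => U n ω * f (Y n ω))
      ((mU n).mul (mF n)) (gi n) (by
        have := (iUF n).mul_bdd (c := ‖g‖) (mg0 n).aestronglyMeasurable
          (Eventually.of_forall fun _ => hgb _)
        simpa only [mul_comm] using this)
    have b := pull (G.le n) I (fun ω => f (Y n ω) * V n ω) ((mF n).mul (mV n)) hIi
      (hIi.mul_bdd (c := ‖f‖ * ‖g‖) ((mF0 n).aestronglyMeasurable.mul (mV0 n)) (bFV n))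
    rw [b]
    calc _ = ∫ ω, g (Z n ω) * (U n ω * f (Y n ω)) ∂μ := by congr 1; ext ω; ring
      _ = _ := a
      _ = _ := by congr 1; ext ω; simp only [hU, hV]; ring
  -- step 4
  have s4 : Tendsto (fun n => ∫ ω, (V n ω - Ng ω) * (I ω * f (Y n ω)) ∂μ) atTop (nhds 0) := by
    refine int_small _ _ ‖f‖ (fun n => integrable_condExp.sub
      (Integrable.of_bound mN.aestronglyMeasurable ‖g‖ (Eventually.of_forall bN)))
      (fun n => Eventually.of_forall fun ω => ?_) ?_
    · rw [abs_mul]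
      exact (mul_le_mul (hIb _) (hfb _) (abs_nonneg _) zero_le_one).trans_eq (one_mul _)
    · exact int_meas V Ng ‖g‖ mV0 mN.aestronglyMeasurable bV bN (hZN g g.continuous ⟨_, hgb⟩)
  -- step 5
  have iING : Integrable (fun ω => I ω * Ng ω) μ :=
    hIi.mul_bdd (c := ‖g‖) mN.aestronglyMeasurable (Eventually.of_forall bN)
  have s5 := stable_ext (μ := μ) (fun n ω => f (Y n ω)) Mf ‖f‖ mF0 mM (fun n ω => hfb _) bM
    (fun K hK => by
      rcases eq_or_ne (μ K) 0 with h0 | h0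
      · simp [Measure.restrict_eq_zero.2 h0]
      · exact hYM K hK (pos_iff_ne_zero.2 h0) f f.continuous ⟨_, hfb⟩)
    (fun ω => I ω * Ng ω) iING
  rw [hset]
  simp only [hset]
  have e0 : ∫ ω, I ω * (Mf ω * Ng ω) ∂μ = ∫ ω, I ω * Ng ω * Mf ω ∂μ := by
    congr 1; ext ω; ring
  rw [e0]
  have hs := (s5.add s4).sub s2
  rw [add_zero, sub_zero] at hs
  refine hs.congr fun n => ?_
  have iB : ∀ (A : Ω → ℝ), Integrable A μ → Integrable (fun ω => A ω * (f (Y n ω) * g (Z n ω))) μ :=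
    fun A hA => hA.mul_bdd (c := ‖f‖ * ‖g‖) ((mF0 n).mul (mg0 n)).aestronglyMeasurable
        (Eventually.of_forall (bFg n))
  have i1 : Integrable (fun ω => I ω * (f (Y n ω) * V n ω)) μ :=
    hIi.mul_bdd (c := ‖f‖ * ‖g‖) ((mF0 n).aestronglyMeasurable.mul (mV0 n)) (bFV n)
  have i2 : Integrable (fun ω => I ω * Ng ω * f (Y n ω)) μ :=
    iING.mul_bdd (c := ‖f‖) (mF0 n).aestronglyMeasurable (Eventually.of_forall fun _ => hfb _)
  have d2 : ∫ ω, (U n ω - Ui ω) * (f (Y n ω) * g (Z n ω)) ∂μ =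
      ∫ ω, U n ω * (f (Y n ω) * g (Z n ω)) ∂μ - ∫ ω, Ui ω * (f (Y n ω) * g (Z n ω)) ∂μ := by
    rw [← integral_sub (iB _ (iU n)) (iB _ iUi)]
    congr 1; ext ω; ring
  have d4 : ∫ ω, (V n ω - Ng ω) * (I ω * f (Y n ω)) ∂μ =
      ∫ ω, I ω * (f (Y n ω) * V n ω) ∂μ - ∫ ω, I ω * Ng ω * f (Y n ω) ∂μ := by
    rw [← integral_sub i1 i2]
    congr 1; ext ω; ring
  rw [s1 n, d2, d4, s3 n]
  ring

theorem stmt10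
    {Ω : Type*} [m0 : MeasurableSpace Ω] {μ : Measure Ω} [IsProbabilityMeasure μ]
    {S : Type*} [MetricSpace S] [TopologicalSpace.SeparableSpace S]
    [MeasurableSpace S] [BorelSpace S]
    (G : Filtration ℕ m0)
    (Y Z : ℕ → Ω → S)
    (hY : ∀ n, Measurable[G n] (Y n))
    (hZ : ∀ n, Measurable[⨆ k, (G k : MeasurableSpace Ω)] (Z n))
    (M N : ProbabilityTheory.Kernel Ω S)
    [IsMarkovKernel M] [IsMarkovKernel N]
    (hYM : ∀ H : Set Ω, MeasurableSet H → 0 < μ H →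
      ∀ f : S → ℝ, Continuous f → (∃ C, ∀ x, |f x| ≤ C) →
        Filter.Tendsto (fun n : ℕ => ∫ ω in H, f (Y n ω) ∂μ) Filter.atTop
          (nhds (∫ ω in H, (∫ x, f x ∂(M ω)) ∂μ)))
    (hZN : ∀ f : S → ℝ, Continuous f → (∃ C, ∀ x, |f x| ≤ C) →
      MeasureTheory.TendstoInMeasure μ
        (fun n ω => (μ[(fun ω' => f (Z n ω')) | G n]) ω)
        Filter.atTop (fun ω => ∫ x, f x ∂(N ω))) :
    ∀ H : Set Ω, MeasurableSet H → 0 < μ H →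
      ∀ f : S × S → ℝ, Continuous f → (∃ C, ∀ x, |f x| ≤ C) →
        Filter.Tendsto (fun n : ℕ => ∫ ω in H, f (Y n ω, Z n ω) ∂μ) Filter.atTop
          (nhds (∫ ω in H, (∫ x, f x ∂((M ω).prod (N ω))) ∂μ)) := by
  intro H hH hpos f hf ⟨C, hC⟩
  have : SecondCountableTopology S := UniformSpace.secondCountable_of_separable S
  have hGle : (⨆ k, (G k : MeasurableSpace Ω)) ≤ m0 := iSup_le fun k => G.le k
  have mY : ∀ n, Measurable (Y n) := fun n => (hY n).mono (G.le n) le_rfl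
  have mZ : ∀ n, Measurable (Z n) := fun n => (hZ n).mono hGle le_rfl
  have hH0 : μ H ≠ 0 := hpos.ne'
  have hHr : (μ H).toReal ≠ 0 := ENNReal.toReal_ne_zero.2 ⟨hH0, measure_ne_top _ _⟩
  let ρ : Measure Ω := (μ H)⁻¹ • μ.restrict H
  have : IsProbabilityMeasure ρ := ⟨by
    simp [ρ, ENNReal.inv_mul_cancel hH0 (measure_ne_top μ H)]⟩
  have hρ : ∀ X : Ω → ℝ, ∫ ω, X ω ∂ρ = (μ H).toReal⁻¹ * ∫ ω in H, X ω ∂μ := by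
    intro X
    simp [ρ, integral_smul_measure]
  let P : ℕ → ProbabilityMeasure (S × S) := fun n =>
    ⟨ρ.map (fun ω => (Y n ω, Z n ω)), Measure.isProbabilityMeasure_map
      ((mY n).prodMk (mZ n)).aemeasurable⟩
  let Q : ProbabilityMeasure (S × S) :=
    ⟨((M ×ₖ N) ∘ₖ Kernel.const Unit ρ) (), inferInstance⟩
  have hP : ∀ n (u : BoundedContinuousFunction (S × S) ℝ),
      ∫ x, u x ∂(P n : Measure (S × S)) =
        (μ H).toReal⁻¹ * ∫ ω in H, u (Y n ω, Z n ω) ∂μ := by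
    intro n u
    rw [← hρ]
    exact integral_map ((mY n).prodMk (mZ n)).aemeasurable u.continuous.aestronglyMeasurable
  have hQ : ∀ (u : BoundedContinuousFunction (S × S) ℝ),
      ∫ x, u x ∂(Q : Measure (S × S)) =
        (μ H).toReal⁻¹ * ∫ ω in H, (∫ x, u x ∂((M ω).prod (N ω))) ∂μ := by
    intro u
    rw [← hρ]
    have := Kernel.integral_comp (κ := Kernel.const Unit ρ) (η := M ×ₖ N) (a := ())
      (f := u) (u.integrable _)
    refine Eq.trans this ?_
    simp [Kernel.prod_apply]
  have hPQ : Tendsto P atTop (nhds Q) := by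
    refine tens_weak P Q fun f g => ?_
    let u : BoundedContinuousFunction (S × S) ℝ :=
      f.compContinuous ⟨Prod.fst, continuous_fst⟩ * g.compContinuous ⟨Prod.snd, continuous_snd⟩
    have h1 := fun n => hP n u
    have h2 := hQ u
    have hu : ∀ x, u x = f x.1 * g x.2 := fun x => rfl
    simp only [hu] at h1 h2
    simp only [h1, h2, integral_prod_mul]
    exact (tens_conv G Y Z hY hZ M N hYM hZN H hH f g).const_mul _
  let F : BoundedContinuousFunction (S × S) ℝ :=
    BoundedContinuousFunction.ofNormedAddCommGroup f hf C hC
  have h := ProbabilityMeasure.tendsto_iff_forall_integral_tendsto.1 hPQ F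
  simp only [hP, hQ] at h
  have h' := h.const_mul (μ H).toReal
  simp only [mul_inv_cancel_left₀ hHr] at h'
  exact h'
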